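/- arXiv:0803.1129 — 2 statements merged into one kernel-verified Lean document; each statement's English description precedes it below -/
import Mathlib

section
/- For each n ≥ 1, the joint distribution of the triple (X_n, Y_n, Z_n) of the numbers of ascents, descents and plateaux of a uniformly random Stirling permutation of length 2n is exchangeable: for every permutation σ of the three coordinates and all nonnegative integers (a,b,c), the number of Stirling permutations of length 2n with exactly a ascents, b descents and c plateaux equals the number with exactly σ(a,b,c) ascents, descents and plateaux respectively. -/
/-- A Stirling permutation of length `2*n`. -/
def IsStirlingPerm (n : ℕ) (l : List ℕ) : Prop :=
  l.length = 2 * n ∧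
  (∀ i : ℕ, 1 ≤ i → i ≤ n → l.count i = 2) ∧
  ∀ p q r : Fin l.length, p < q → q < r → l.get p = l.get r → l.get p < l.get q

/-- The extended sequence `a_0 a_1 … a_{2n} a_{2n+1}` with the convention
`a_0 = a_{2n+1} = 0`: `ext l i = a_i`. -/
def ext (l : List ℕ) (i : ℕ) : ℕ := if i = 0 then 0 else l.getD (i - 1) 0

/-- The number of ascents of `l`: indices `i ∈ {0,…,2n}` with `a_i < a_{i+1}`. -/
def ascents (l : List ℕ) : ℕ :=
  ((Finset.range (l.length + 1)).filter (fun i => ext l i < ext l (i + 1))).card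

/-- The number of descents of `l`: indices `i ∈ {0,…,2n}` with `a_i > a_{i+1}`. -/
def descents (l : List ℕ) : ℕ :=
  ((Finset.range (l.length + 1)).filter (fun i => ext l i > ext l (i + 1))).card

/-- The number of plateaux of `l`: indices `i ∈ {0,…,2n}` with `a_i = a_{i+1}`. -/
def plateaux (l : List ℕ) : ℕ :=
  ((Finset.range (l.length + 1)).filter (fun i => ext l i = ext l (i + 1))).card

/-- The triple of statistics (number of ascents, of descents, of plateaux) of `l`,
as a function `Fin 3 → ℕ`. -/
def statTriple (l : List ℕ) : Fin 3 → ℕ := ![ascents l, descents l, plateaux l]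

/-- The kind of the gap between consecutive letters `a` and `b`: `0` for an ascent, `1` for a
descent, `2` for a plateau. -/
def gapKind (a b : ℕ) : Fin 3 := if a < b then 0 else if b < a then 1 else 2

theorem statTriple_apply (l : List ℕ) (t : Fin 3) :
    statTriple l t = ((Finset.range (l.length + 1)).filter
      (fun i => gapKind (ext l i) (ext l (i + 1)) = t)).card := by
  fin_cases t
  all_goals
    simp only [statTriple, ascents, descents, plateaux, gapKind, Fin.zero_eta, Fin.mk_one,
      Fin.reduceFinMk, Matrix.cons_val]
    congr 1
    apply Finset.filter_congr
    intro i _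
    split_ifs <;> simp <;> omega

/-- Insert two adjacent copies of `m` into `l` at position `i`. -/
def insertPair (m : ℕ) (l : List ℕ) (i : ℕ) : List ℕ := l.take i ++ m :: m :: l.drop i

theorem length_insertPair (m : ℕ) (l : List ℕ) (i : ℕ) :
    (insertPair m l i).length = l.length + 2 := by
  simp only [insertPair, List.length_append, List.length_cons, List.length_take, List.length_drop]
  omega

theorem ext_insertPair_of_le {m : ℕ} {l : List ℕ} {i j : ℕ} (hi : i ≤ l.length) (hj : j ≤ i) :
    ext (insertPair m l i) j = ext l j := by
  unfold ext insertPair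
  split_ifs with h
  · rfl
  · rw [List.getD_append _ _ _ _ (by simp; omega)]
    simp only [List.getD_eq_getElem?_getD]
    rw [List.getElem?_take_of_lt (by omega)]

theorem ext_insertPair_add_one {m : ℕ} {l : List ℕ} {i : ℕ} (hi : i ≤ l.length) :
    ext (insertPair m l i) (i + 1) = m := by
  simp [ext, insertPair, hi]

theorem ext_insertPair_add_two {m : ℕ} {l : List ℕ} {i : ℕ} (hi : i ≤ l.length) :
    ext (insertPair m l i) (i + 2) = m := by
  simp [ext, insertPair, hi]

theorem ext_insertPair_add {m : ℕ} {l : List ℕ} {i : ℕ} (hi : i ≤ l.length) (j : ℕ) :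
    ext (insertPair m l i) (i + 3 + j) = ext l (i + 1 + j) := by
  have h : i + 2 + j - i = j + 2 := by omega
  have h1 : ¬ i + 2 + j < i := by omega
  have h2 : i + 3 + j - 1 = i + 2 + j := by omega
  have h3 : i + 1 + j - 1 = i + j := by omega
  simp [ext, insertPair, List.getElem?_append, hi, h, h1, h2, h3]

theorem ext_lt {m : ℕ} {l : List ℕ} (hm : 0 < m) (hl : ∀ x ∈ l, x < m) (i : ℕ) : ext l i < m := by
  unfold ext
  split_ifs
  · exact hm
  · rw [List.getD_eq_getElem?_getD]
    rcases h : l[i - 1]? with _ | x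
    · simpa using hm
    · simpa using hl x (List.mem_of_getElem? h)

/-- Filling a gap of kind `t` with a pair of large letters raises every coordinate of the
statistics by one, except the coordinate `t`. -/
def raiseExcept (v : Fin 3 → ℕ) (t : Fin 3) : Fin 3 → ℕ := fun s => if s = t then v s else v s + 1

theorem statTriple_insertPair {m : ℕ} {l : List ℕ} {i : ℕ} (hm : 0 < m) (hl : ∀ x ∈ l, x < m)
    (hi : i ≤ l.length) :
    statTriple (insertPair m l i)
      = raiseExcept (statTriple l) (gapKind (ext l i) (ext l (i + 1))) := by
  funext t
  obtain ⟨k, hk⟩ := Nat.exists_eq_add_of_le hi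
  have e1 : (insertPair m l i).length + 1 = i + 3 + k := by rw [length_insertPair]; omega
  have e2 : l.length + 1 = i + 1 + k := by omega
  have below : ∀ j ∈ Finset.range i,
      (if gapKind (ext (insertPair m l i) j) (ext (insertPair m l i) (j + 1)) = t then 1 else 0)
        = if gapKind (ext l j) (ext l (j + 1)) = t then 1 else 0 := by
    intro j hj
    have := Finset.mem_range.1 hj
    rw [ext_insertPair_of_le hi (by omega), ext_insertPair_of_le hi (by omega)]
  have k1 : gapKind (ext l i) m = 0 := by simp [gapKind, ext_lt hm hl]
  have k2 : gapKind m m = 2 := by simp [gapKind]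
  have k3 : gapKind m (ext l (i + 1)) = 1 := by
    simp [gapKind, ext_lt hm hl, (ext_lt hm hl (i + 1)).le]
  have h3 : ext (insertPair m l i) (i + 3) = ext l (i + 1) := ext_insertPair_add hi 0
  simp only [raiseExcept, statTriple_apply, Finset.card_filter, e1, e2]
  simp only [Finset.sum_range_add _ _ k, Finset.sum_range_succ _ (i + 2),
    Finset.sum_range_succ _ (i + 1), Finset.sum_range_succ _ i, Finset.sum_congr rfl below,
    ext_insertPair_of_le hi le_rfl, ext_insertPair_add_one hi, ext_insertPair_add_two hi,
    add_assoc (i + 3), add_assoc (i + 1), ext_insertPair_add hi, h3, k1, k2, k3]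
  generalize gapKind (ext l i) (ext l (i + 1)) = s
  have : (if (0 : Fin 3) = t then 1 else 0) + (if (2 : Fin 3) = t then 1 else 0)
      + (if (1 : Fin 3) = t then 1 else 0) = 1 := by
    fin_cases t <;> rfl
  by_cases h : t = s
  · subst h
    simp only [if_true]
    omega
  · simp only [h, Ne.symm h, if_false]
    omega

theorem IsStirlingPerm.coe_eq {n : ℕ} {l : List ℕ} (h : IsStirlingPerm n l) :
    (l : Multiset ℕ) = ∑ i ∈ Finset.Icc 1 n, Multiset.replicate 2 i := by
  symm
  apply Multiset.eq_of_le_of_card_le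
  · rw [Multiset.le_iff_count]
    intro a
    rw [Multiset.count_sum']
    simp only [Multiset.count_replicate, Finset.sum_ite_eq', Multiset.coe_count]
    split_ifs with ha
    · rw [Finset.mem_Icc] at ha
      exact (h.2.1 a ha.1 ha.2).ge
    · exact Nat.zero_le _
  · simp [h.1, mul_comm]

theorem IsStirlingPerm.le_of_mem {n : ℕ} {l : List ℕ} (h : IsStirlingPerm n l) {x : ℕ}
    (hx : x ∈ l) : x ≤ n := by
  rw [← Multiset.mem_coe, h.coe_eq, Multiset.mem_sum] at hx
  obtain ⟨i, hi, hx⟩ := hx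
  rw [Multiset.eq_of_mem_replicate hx]
  exact (Finset.mem_Icc.1 hi).2

theorem forall_get_iff_sublist (l : List ℕ) :
    (∀ p q r : Fin l.length, p < q → q < r → l.get p = l.get r → l.get p < l.get q)
      ↔ ∀ x y, List.Sublist [x, y, x] l → x < y := by
  constructor
  · intro h x y hs
    obtain ⟨f, hf⟩ := List.sublist_iff_exists_fin_orderEmbedding_get_eq.1 hs
    have h0 := hf ⟨0, by simp⟩
    have h1 := hf ⟨1, by simp⟩
    have h2 := hf ⟨2, by simp⟩
    have := h (f ⟨0, by simp⟩) (f ⟨1, by simp⟩) (f ⟨2, by simp⟩) (by simp) (by simp)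
      (by rw [← h0, ← h2]; rfl)
    rwa [← h0, ← h1] at this
  · intro h p q r hpq hqr e
    apply h
    have hs : (List.Sublist ([p, q, r].map (l[·])) l) :=
      List.map_getElem_sublist (by simp [hpq, hqr, hpq.trans hqr])
    simp only [List.get_eq_getElem] at e
    simpa [← e] using hs

theorem filter_insertPair {m : ℕ} {l : List ℕ} (hl : m ∉ l) (i : ℕ) :
    (insertPair m l i).filter (· ≠ m) = l := by
  have h : (l.take i ++ l.drop i).filter (· ≠ m) = l := by
    rw [List.take_append_drop, List.filter_eq_self]
    intro a ha
    simpa using fun e : a = m => hl (e ▸ ha)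
  rw [List.filter_append] at h
  simpa [insertPair] using h

theorem idxOf_insertPair {m : ℕ} {l : List ℕ} (hl : m ∉ l) {i : ℕ} (hi : i ≤ l.length) :
    (insertPair m l i).idxOf m = i := by
  rw [insertPair, List.idxOf_append_of_notMem fun h => hl (List.mem_of_mem_take h)]
  simpa using hi

theorem IsStirlingPerm.insertPair {n : ℕ} {l : List ℕ} (h : IsStirlingPerm n l) (i : ℕ) :
    IsStirlingPerm (n + 1) (insertPair (n + 1) l i) := by
  have hm : n + 1 ∉ l := fun hx => by have := h.le_of_mem hx; omega
  have hcount (a : ℕ) : (_root_.insertPair (n + 1) l i).count a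
      = l.count a + if n + 1 = a then 2 else 0 := by
    have : (l.take i ++ l.drop i).count a = l.count a := by rw [List.take_append_drop]
    rw [List.count_append] at this
    simp only [_root_.insertPair, List.count_append, List.count_cons, beq_iff_eq]
    split_ifs <;> omega
  have hmem (x : ℕ) (hx : x ∈ _root_.insertPair (n + 1) l i) : x = n + 1 ∨ x ∈ l := by
    have := List.count_pos_iff.2 hx
    rw [hcount] at this
    by_cases e : n + 1 = x
    · exact Or.inl e.symm
    · rw [if_neg e] at this
      exact Or.inr (List.count_pos_iff.1 this)
  refine ⟨by rw [length_insertPair, h.1]; ring, ?_, ?_⟩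
  · intro a h1 h2
    rw [hcount]
    split_ifs with e
    · subst e
      simp [List.count_eq_zero.2 hm]
    · exact h.2.1 a h1 (by omega)
  · rw [forall_get_iff_sublist]
    intro x y hs
    by_cases hx : x = n + 1
    · exfalso
      subst hx
      rw [_root_.insertPair, List.sublist_append_iff] at hs
      obtain ⟨p, q, e, hp, hq⟩ := hs
      rcases p with _ | ⟨a, p⟩
      · rw [List.nil_append] at e
        subst e
        rw [List.cons_sublist_cons] at hq
        have : n + 1 ∈ l.drop i := by
          cases hq with
          | cons _ hq => exact hq.subset (by simp)
          | cons_cons _ hq => exact hq.subset (by simp)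
        exact hm (List.mem_of_mem_drop this)
      · rw [List.cons_append, List.cons.injEq] at e
        exact hm (List.mem_of_mem_take (hp.subset (by simp [e.1])))
    · have hxl : x ∈ l := (hmem x (hs.subset (by simp))).resolve_left hx
      by_cases hy : y = n + 1
      · have := h.le_of_mem hxl
        omega
      · have := hs.filter (· ≠ n + 1)
        rw [filter_insertPair hm] at this
        exact (forall_get_iff_sublist l).1 h.2.2 x y (by simpa [hx, hy] using this)

theorem IsStirlingPerm.exists_insertPair {n : ℕ} {l : List ℕ} (h : IsStirlingPerm (n + 1) l) :
    ∃ l' i, IsStirlingPerm n l' ∧ i ≤ l'.length ∧ _root_.insertPair (n + 1) l' i = l := by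
  have hc := h.2.1 (n + 1) (by omega) le_rfl
  have hs := (forall_get_iff_sublist l).1 h.2.2
  obtain ⟨u, w, rfl, hu⟩ := List.eq_append_cons_of_mem
    (List.count_pos_iff.1 (by omega : 0 < l.count (n + 1)))
  rw [List.count_append, List.count_cons_self, List.count_eq_zero.2 hu] at hc
  obtain ⟨z, w, rfl, -⟩ := List.eq_append_cons_of_mem
    (List.count_pos_iff.1 (by omega : 0 < w.count (n + 1)))
  have hz : z = [] := by
    rcases z with _ | ⟨y, z⟩
    · rfl
    · have hlt := hs (n + 1) y (by
        refine List.Sublist.trans ?_ (List.sublist_append_right _ _)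
        simp)
      have := h.le_of_mem (x := y) (by simp)
      omega
  subst hz
  rw [List.nil_append] at *
  refine ⟨u ++ w, u.length, ⟨?_, ?_, ?_⟩, by simp, by simp [_root_.insertPair]⟩
  · have := h.1
    simp only [List.length_append, List.length_cons] at this ⊢
    omega
  · intro a h1 h2
    have := h.2.1 a h1 (by omega)
    simpa [List.count_append, List.count_cons, show n + 1 ≠ a by omega] using this
  · rw [forall_get_iff_sublist]
    intro x y hxy
    refine hs x y (hxy.trans ?_)
    exact (List.Sublist.refl u).append ((List.sublist_cons_self _ _).trans
      (List.sublist_cons_self _ _))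

/-- The finite set of Stirling permutations of length `2 * n`. -/
def stirlingPerms : ℕ → Finset (List ℕ)
  | 0 => {[]}
  | n + 1 => (stirlingPerms n ×ˢ Finset.range (2 * n + 1)).image
      fun p => insertPair (n + 1) p.1 p.2

theorem mem_stirlingPerms {n : ℕ} {l : List ℕ} : l ∈ stirlingPerms n ↔ IsStirlingPerm n l := by
  induction n generalizing l with
  | zero =>
    simp only [stirlingPerms, Finset.mem_singleton]
    constructor
    · rintro rfl
      exact ⟨rfl, by intro i _ _; omega, fun p => p.elim0⟩
    · intro h
      exact List.length_eq_zero_iff.1 h.1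
  | succ n ih =>
    simp only [stirlingPerms, Finset.mem_image, Finset.mem_product, Finset.mem_range, ih,
      Prod.exists]
    constructor
    · rintro ⟨l, i, ⟨h, -⟩, rfl⟩
      exact h.insertPair i
    · intro h
      obtain ⟨l', i, h', hi, e⟩ := h.exists_insertPair
      exact ⟨l', i, ⟨h', by rw [h'.1] at hi; omega⟩, e⟩

theorem sum_stirlingPerms_succ (n : ℕ) (f : (Fin 3 → ℕ) → ℕ) :
    ∑ l ∈ stirlingPerms (n + 1), f (statTriple l)
      = ∑ l ∈ stirlingPerms n, ∑ t, statTriple l t * f (raiseExcept (statTriple l) t) := by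
  have hm {l : List ℕ} (h : IsStirlingPerm n l) : n + 1 ∉ l := fun hx => by
    have := h.le_of_mem hx
    omega
  rw [stirlingPerms, Finset.sum_image, Finset.sum_product]
  · refine Finset.sum_congr rfl fun l hl => ?_
    rw [mem_stirlingPerms] at hl
    rw [← hl.1, ← Finset.sum_fiberwise _ fun i => gapKind (ext l i) (ext l (i + 1))]
    refine Finset.sum_congr rfl fun t _ => ?_
    rw [statTriple_apply, ← smul_eq_mul, ← Finset.sum_const]
    refine Finset.sum_congr rfl fun i hi => ?_
    rw [Finset.mem_filter, Finset.mem_range] at hi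
    rw [statTriple_insertPair n.succ_pos (fun x hx => Nat.lt_succ_of_le (hl.le_of_mem hx))
      (Nat.le_of_lt_succ hi.1), hi.2]
  · rintro ⟨l, i⟩ h ⟨l', i'⟩ h' e
    simp only [Finset.coe_product, Set.mem_prod, Finset.mem_coe, mem_stirlingPerms,
      Finset.mem_range] at h h' e
    have hl := congrArg (List.filter (· ≠ n + 1)) e
    rw [filter_insertPair (hm h.1), filter_insertPair (hm h'.1)] at hl
    have hi := congrArg (List.idxOf (n + 1)) e
    rw [idxOf_insertPair (hm h.1) (by rw [h.1.1]; omega),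
      idxOf_insertPair (hm h'.1) (by rw [h'.1.1]; omega)] at hi
    rw [hl, hi]

theorem raiseExcept_comp (v : Fin 3 → ℕ) (σ : Equiv.Perm (Fin 3)) (t : Fin 3) :
    raiseExcept v (σ t) ∘ σ = raiseExcept (v ∘ σ) t := by
  funext s
  simp [raiseExcept]

theorem sum_statTriple_comp (n : ℕ) (hn : 1 ≤ n) (σ : Equiv.Perm (Fin 3)) (f : (Fin 3 → ℕ) → ℕ) :
    ∑ l ∈ stirlingPerms n, f (statTriple l ∘ σ) = ∑ l ∈ stirlingPerms n, f (statTriple l) := by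
  induction n, hn using Nat.le_induction generalizing f with
  | base =>
    have h : statTriple (insertPair 1 [] 0) = fun _ => 1 := by
      funext t
      fin_cases t <;> decide
    have h' : stirlingPerms 1 = {insertPair 1 [] 0} := rfl
    simp [h', h, Function.comp_def]
  | succ n _ ih =>
    rw [sum_stirlingPerms_succ, sum_stirlingPerms_succ n fun v => f (v ∘ σ),
      ← ih fun v => ∑ t, v t * f (raiseExcept v t)]
    refine Finset.sum_congr rfl fun l _ => ?_
    rw [← Equiv.sum_comp σ]
    simp only [raiseExcept_comp, Function.comp_apply]

theorem ncard_statTriple_eq (n : ℕ) (p : (Fin 3 → ℕ) → Prop) [DecidablePred p] :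
    {l : List ℕ | IsStirlingPerm n l ∧ p (statTriple l)}.ncard
      = ∑ l ∈ stirlingPerms n, if p (statTriple l) then 1 else 0 := by
  rw [← Finset.card_filter, ← Set.ncard_coe_finset]
  congr 1
  ext l
  simp [mem_stirlingPerms]

/-- Exchangeability of `(X_n, Y_n, Z_n)`: for each `n ≥ 1`, for every permutation `σ`
of the three coordinates and every prescribed triple of values `v = (a,b,c)`, the
number of Stirling permutations of length `2n` whose triple of statistics equals `v`
equals the number whose triple of statistics equals `v` permuted by `σ`. -/
theorem statTriple_exchangeable (n : ℕ) (hn : 1 ≤ n) (σ : Equiv.Perm (Fin 3))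
    (v : Fin 3 → ℕ) :
    {l : List ℕ | IsStirlingPerm n l ∧ statTriple l = v}.ncard
      = {l : List ℕ | IsStirlingPerm n l ∧ statTriple l = v ∘ σ}.ncard := by
  rw [ncard_statTriple_eq n (· = v), ncard_statTriple_eq n (· = v ∘ σ),
    ← sum_statTriple_comp n hn σ fun w => if w = v ∘ σ then 1 else 0]
  simp only [σ.surjective.injective_comp_right.eq_iff]
end

section
/- For every n ≥ 1, the variance of the number of plateaux of a uniformly random Stirling permutation of length 2n equals 2(n²-1)/(9(2n-1)), and the same formula gives the variance of the number of ascents and the variance of the number of descents: Var X_n = Var Y_n = Var Z_n = 2(n²-1)/(9(2n-1)). -/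
/-- The expectation of a statistic `f` under the uniform distribution on the set of
Stirling permutations of length `2n`. -/
noncomputable def stirlingExp (n : ℕ) (f : List ℕ → ℝ) : ℝ :=
  (∑ᶠ l ∈ {l : List ℕ | IsStirlingPerm n l}, f l)
    / ({l : List ℕ | IsStirlingPerm n l}.ncard : ℝ)

/-- The variance of a statistic `f` under the uniform distribution on the set of
Stirling permutations of length `2n`. -/
noncomputable def stirlingVar (n : ℕ) (f : List ℕ → ℝ) : ℝ :=
  stirlingExp n (fun l => (f l - stirlingExp n f) ^ 2)

/-- The covariance of two statistics `f`, `g` under the uniform distribution on the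
set of Stirling permutations of length `2n`. -/
noncomputable def stirlingCov (n : ℕ) (f g : List ℕ → ℝ) : ℝ :=
  stirlingExp n (fun l => (f l - stirlingExp n f) * (g l - stirlingExp n g))

/-- The list obtained from `l` by inserting two adjacent copies of `m` after its first `k`
entries. -/
def insertTwins (m : ℕ) (l : List ℕ) (k : ℕ) : List ℕ :=
  l.take k ++ m :: m :: l.drop k

/-- The number of indices `i ∈ {0,…,l.length}` with `R a_i a_{i+1}`. -/
def gapCount (R : ℕ → ℕ → Prop) [DecidableRel R] (l : List ℕ) : ℕ :=
  ((Finset.range (l.length + 1)).filter (fun i => R (ext l i) (ext l (i + 1)))).card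

/-- The Stirling permutations of length `2 * n`, built by successively inserting `n n`. -/
def stirlingFinset : ℕ → Finset (List ℕ)
  | 0 => {[]}
  | n + 1 => (stirlingFinset n ×ˢ Finset.range (2 * n + 1)).image
      fun p => insertTwins (n + 1) p.1 p.2

section Structure

theorem forall_get_lt_iff_sublist (l : List ℕ) :
    (∀ p q r : Fin l.length, p < q → q < r → l.get p = l.get r → l.get p < l.get q) ↔
      ∀ a b, [a, b, a].Sublist l → a < b := by
  constructor
  · intro h a b hs
    obtain ⟨f, hf⟩ := List.sublist_iff_exists_fin_orderEmbedding_get_eq.1 hs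
    have h0 := hf ⟨0, by simp⟩
    have h1 := hf ⟨1, by simp⟩
    have h2 := hf ⟨2, by simp⟩
    simp only [List.get_eq_getElem, List.getElem_cons_zero, List.getElem_cons_succ] at h0 h1 h2
    have := h (f ⟨0, by simp⟩) (f ⟨1, by simp⟩) (f ⟨2, by simp⟩) (by simp) (by simp)
      (by simp only [List.get_eq_getElem, ← h0, ← h2])
    simpa only [List.get_eq_getElem, ← h0, ← h1] using this
  · intro h p q r hpq hqr he
    apply h
    have hs : (List.map l.get [p, q, r]).Sublist l := by
      apply List.map_getElem_sublist
      simp [hpq, hqr, hpq.trans hqr]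
    simpa only [List.map_cons, List.map_nil, ← he] using hs

theorem IsStirlingPerm.mem_Icc {n : ℕ} {l : List ℕ} (h : IsStirlingPerm n l) {x : ℕ}
    (hx : x ∈ l) : x ∈ Finset.Icc 1 n := by
  by_contra hn
  have h1 : ∑ i ∈ Finset.Icc 1 n ∪ l.toFinset, l.count i = l.length := by
    simpa using Multiset.sum_count_eq_card (s := Finset.Icc 1 n ∪ l.toFinset) (m := (l : Multiset ℕ))
      (by intro a ha; simp at ha; simp [ha])
  have h2 : ∑ i ∈ Finset.Icc 1 n, l.count i = 2 * n := by
    rw [Finset.sum_congr rfl (fun i hi => h.2.1 i (Finset.mem_Icc.1 hi).1 (Finset.mem_Icc.1 hi).2)]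
    simp [mul_comm]
  have h3 : ∑ i ∈ Finset.Icc 1 n, l.count i < ∑ i ∈ Finset.Icc 1 n ∪ l.toFinset, l.count i :=
    Finset.sum_lt_sum_of_subset Finset.subset_union_left (i := x) (by simp [hx]) hn
      (List.count_pos_iff.2 hx) (by simp)
  have := h.1
  omega

theorem isStirlingPerm_zero_iff (l : List ℕ) : IsStirlingPerm 0 l ↔ l = [] := by
  constructor
  · intro h
    simpa using h.1
  · rintro rfl
    refine ⟨rfl, ?_, fun p => p.elim0⟩
    intro i h1 h2
    omega

theorem filter_ne_append_twins {m : ℕ} {u v : List ℕ} (h : m ∉ u ++ v) :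
    (u ++ m :: m :: v).filter (fun x => decide (x ≠ m)) = u ++ v := by
  rw [List.filter_append, List.filter_cons_of_neg (by simp), List.filter_cons_of_neg (by simp),
    ← List.filter_append]
  refine List.filter_eq_self.2 fun x hx => decide_eq_true ?_
  rintro rfl
  exact h hx

theorem IsStirlingPerm.append_twins {n : ℕ} {u v : List ℕ} (h : IsStirlingPerm n (u ++ v)) :
    IsStirlingPerm (n + 1) (u ++ (n + 1) :: (n + 1) :: v) := by
  have hlt : ∀ x ∈ u ++ v, x < n + 1 := fun x hx => by
    have := Finset.mem_Icc.1 (h.mem_Icc hx); omega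
  have hu : n + 1 ∉ u := fun hm => (hlt _ (by simp [hm])).false
  have hv : n + 1 ∉ v := fun hm => (hlt _ (by simp [hm])).false
  have h3 := (forall_get_lt_iff_sublist _).1 h.2.2
  refine ⟨?_, ?_, (forall_get_lt_iff_sublist _).2 ?_⟩
  · have := h.1
    simp at this ⊢
    omega
  · intro i h1 h2
    by_cases hi : i = n + 1
    · subst hi
      simp [List.count_eq_zero_of_not_mem hu, List.count_eq_zero_of_not_mem hv]
    · have := h.2.1 i h1 (by omega)
      rw [List.count_append] at this
      rw [List.count_append, List.count_cons_of_ne (Ne.symm hi), List.count_cons_of_ne (Ne.symm hi),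
        this]
  · intro a b hs
    by_cases ha : a = n + 1
    · subst ha
      exfalso
      obtain ⟨l₁, l₂, he, hs1, hs2⟩ := List.sublist_append_iff.1 hs
      have hl₁ : l₁ = [] := by
        rcases l₁ with _ | ⟨c, t⟩
        · rfl
        · simp only [List.cons_append, List.cons.injEq] at he
          exact absurd (hs1.subset (by simp [he.1])) hu
      subst hl₁
      simp only [List.nil_append] at he
      subst he
      have hs3 := List.cons_sublist_cons.1 hs2
      rcases List.sublist_cons_iff.1 hs3 with hs4 | ⟨r, hr, hs4⟩
      · exact hv (hs4.subset (by simp))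
      · simp only [List.cons.injEq] at hr
        exact hv (hs4.subset (by simp [← hr.2]))
    · have hau : a ∈ u ++ v := by
        have := hs.subset (show a ∈ [a, b, a] by simp)
        simpa [ha] using this
      by_cases hb : b = n + 1
      · exact hb ▸ hlt a hau
      · apply h3
        have hf := hs.filter (fun x => decide (x ≠ n + 1))
        rw [filter_ne_append_twins (by simp [hu, hv])] at hf
        simpa [List.filter_cons, ha, hb] using hf

theorem IsStirlingPerm.exists_append_twins {n : ℕ} {l : List ℕ} (h : IsStirlingPerm (n + 1) l) :
    ∃ u v, l = u ++ (n + 1) :: (n + 1) :: v ∧ IsStirlingPerm n (u ++ v) := by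
  have hc := h.2.1 (n + 1) (by omega) le_rfl
  have h3 := (forall_get_lt_iff_sublist _).1 h.2.2
  obtain ⟨u, w, rfl, hu⟩ := List.eq_append_cons_of_mem (List.count_pos_iff.1 (hc ▸ two_pos))
  rw [List.count_append, List.count_eq_zero_of_not_mem hu, List.count_cons_self] at hc
  rcases w with _ | ⟨b, v⟩
  · simp at hc
  have hb : b = n + 1 := by
    by_contra hb
    rw [List.count_cons_of_ne hb] at hc
    have hv : n + 1 ∈ v := List.count_pos_iff.1 (by omega)
    have hs : [n + 1, b, n + 1].Sublist (u ++ (n + 1) :: b :: v) :=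
      List.Sublist.trans (by simpa using hv) (List.sublist_append_right u _)
    have h4 := h3 _ _ hs
    have := Finset.mem_Icc.1 (h.mem_Icc (x := b) (by simp))
    omega
  subst hb
  have hsub : (u ++ v).Sublist (u ++ (n + 1) :: (n + 1) :: v) :=
    (List.Sublist.refl u).append (by simp)
  refine ⟨u, v, rfl, ?_, ?_, (forall_get_lt_iff_sublist _).2 fun a b hab => h3 a b (hab.trans hsub)⟩
  · have := h.1
    simp at this ⊢
    omega
  · intro i h1 h2
    have := h.2.1 i h1 (by omega)
    rw [List.count_append, List.count_cons_of_ne (by omega), List.count_cons_of_ne (by omega)] at this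
    rw [List.count_append, this]

theorem mem_stirlingFinset {n : ℕ} {l : List ℕ} : l ∈ stirlingFinset n ↔ IsStirlingPerm n l := by
  induction n generalizing l with
  | zero => rw [isStirlingPerm_zero_iff]; simp [stirlingFinset]
  | succ n ih =>
    simp only [stirlingFinset, Finset.mem_image, Finset.mem_product, Finset.mem_range, Prod.exists]
    constructor
    · rintro ⟨w, k, ⟨hw, -⟩, rfl⟩
      apply IsStirlingPerm.append_twins
      rw [List.take_append_drop]
      exact ih.1 hw
    · intro h
      obtain ⟨u, v, rfl, huv⟩ := h.exists_append_twins
      refine ⟨u ++ v, u.length, ⟨ih.2 huv, ?_⟩, by simp [insertTwins]⟩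
      have := huv.1
      simp at this
      omega

theorem insertTwins_injOn (n : ℕ) :
    Set.InjOn (fun p : List ℕ × ℕ => insertTwins (n + 1) p.1 p.2)
      (stirlingFinset n ×ˢ Finset.range (2 * n + 1) : Finset (List ℕ × ℕ)) := by
  have key : ∀ p ∈ (stirlingFinset n ×ˢ Finset.range (2 * n + 1) : Finset (List ℕ × ℕ)),
      (insertTwins (n + 1) p.1 p.2).filter (fun x => decide (x ≠ n + 1)) = p.1 ∧
        (insertTwins (n + 1) p.1 p.2).idxOf (n + 1) = p.2 := by
    rintro ⟨l, k⟩ hp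
    simp only [Finset.mem_product, Finset.mem_range, mem_stirlingFinset] at hp
    obtain ⟨hl, hk⟩ := hp
    have hm : n + 1 ∉ l := fun h => by
      have := Finset.mem_Icc.1 (hl.mem_Icc h); omega
    constructor
    · simp only [insertTwins]
      rw [filter_ne_append_twins (by rwa [List.take_append_drop]), List.take_append_drop]
    · simp only [insertTwins]
      rw [List.idxOf_append_of_notMem (fun h => hm (List.mem_of_mem_take h)), List.idxOf_cons_self,
        List.length_take, hl.1]
      omega
  intro p hp q hq h
  have hp' := key p hp
  have hq' := key q hq
  simp only at h
  rw [h] at hp'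
  exact Prod.ext (hp'.1.symm.trans hq'.1) (hp'.2.symm.trans hq'.2)

end Structure

section Gaps

variable (R : ℕ → ℕ → Prop) [DecidableRel R]

theorem ext_insertTwins_of_le (m : ℕ) {l : List ℕ} {k i : ℕ} (hk : k ≤ l.length) (hi : i ≤ k) :
    ext (insertTwins m l k) i = ext l i := by
  unfold ext insertTwins
  split_ifs with h0
  · rfl
  · rw [List.getD_append _ _ _ _ (by simp; omega)]
    simp [List.getD_eq_getElem?_getD, show i - 1 < k by omega]

theorem ext_insertTwins_add_one (m : ℕ) {l : List ℕ} {k : ℕ} (hk : k ≤ l.length) :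
    ext (insertTwins m l k) (k + 1) = m := by
  simp [ext, insertTwins, List.getD_eq_getElem?_getD, hk]

theorem ext_insertTwins_add_two (m : ℕ) {l : List ℕ} {k : ℕ} (hk : k ≤ l.length) :
    ext (insertTwins m l k) (k + 2) = m := by
  simp [ext, insertTwins, List.getD_eq_getElem?_getD, hk]

theorem ext_insertTwins_add_three (m : ℕ) {l : List ℕ} {k : ℕ} (hk : k ≤ l.length) (j : ℕ) :
    ext (insertTwins m l k) (k + 3 + j) = ext l (k + 1 + j) := by
  unfold ext insertTwins
  rw [if_neg (by omega), if_neg (by omega), List.getD_append_right _ _ _ _ (by simp; omega)]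
  rw [List.length_take, min_eq_left hk, show k + 3 + j - 1 - k = j + 2 by omega,
    show k + 1 + j - 1 = k + j by omega]
  simp [List.getD_eq_getElem?_getD]

theorem ext_lt_s8 {n : ℕ} {l : List ℕ} (h : IsStirlingPerm n l) (i : ℕ) : ext l i < n + 1 := by
  unfold ext
  split_ifs
  · omega
  · by_cases hi : i - 1 < l.length
    · rw [List.getD_eq_getElem _ _ hi]
      have := Finset.mem_Icc.1 (h.mem_Icc (List.getElem_mem hi))
      omega
    · rw [List.getD_eq_default _ _ (by omega)]
      omega

/-- `R` holds for exactly one of the three gaps created by inserting `m m` between smaller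
entries. -/
def OneNewGap : Prop :=
  ∀ a b m : ℕ, a < m → b < m →
    (if R a m then 1 else 0) + (if R m m then 1 else 0) + (if R m b then 1 else 0) = 1

variable {R}

theorem gapCount_insertTwins (hR : OneNewGap R) {n : ℕ} {l : List ℕ} (h : IsStirlingPerm n l)
    {k : ℕ} (hk : k ≤ 2 * n) :
    gapCount R (insertTwins (n + 1) l k) + (if R (ext l k) (ext l (k + 1)) then 1 else 0)
      = gapCount R l + 1 := by
  have hkl : k ≤ l.length := h.1 ▸ hk
  obtain ⟨d, hd⟩ := Nat.exists_eq_add_of_le hkl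
  have hlen : (insertTwins (n + 1) l k).length = l.length + 2 := by
    simp [insertTwins]; omega
  simp only [gapCount, Finset.card_filter, hlen]
  rw [show l.length + 2 + 1 = k + 1 + 1 + 1 + d by omega,
    show l.length + 1 = k + 1 + d by omega]
  simp only [Finset.sum_range_add, Finset.sum_range_succ _ k, Finset.sum_range_succ _ (k + 1),
    Finset.sum_range_succ _ (k + 1 + 1)]
  have e1 : ∑ i ∈ Finset.range k, (if R (ext (insertTwins (n + 1) l k) i)
        (ext (insertTwins (n + 1) l k) (i + 1)) then 1 else 0)
      = ∑ i ∈ Finset.range k, (if R (ext l i) (ext l (i + 1)) then 1 else 0) := by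
    refine Finset.sum_congr rfl fun i hi => ?_
    have := Finset.mem_range.1 hi
    rw [ext_insertTwins_of_le _ hkl (by omega), ext_insertTwins_of_le _ hkl (by omega)]
  have e2 : ∑ i ∈ Finset.range d, (if R (ext (insertTwins (n + 1) l k) (k + 1 + 1 + 1 + i))
        (ext (insertTwins (n + 1) l k) (k + 1 + 1 + 1 + i + 1)) then 1 else 0)
      = ∑ i ∈ Finset.range d, (if R (ext l (k + 1 + i)) (ext l (k + 1 + i + 1)) then 1 else 0) := by
    refine Finset.sum_congr rfl fun i _ => ?_
    have a1 := ext_insertTwins_add_three (n + 1) hkl i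
    have a2 := ext_insertTwins_add_three (n + 1) hkl (i + 1)
    simp only [← add_assoc] at a1 a2 ⊢
    rw [a1, a2]
  rw [e1, e2, ext_insertTwins_of_le _ hkl le_rfl, ext_insertTwins_add_one _ hkl,
    ext_insertTwins_add_two _ hkl]
  have e3 : ext (insertTwins (n + 1) l k) (k + 1 + 1 + 1) = ext l (k + 1) :=
    ext_insertTwins_add_three (n + 1) hkl 0
  rw [e3]
  have := hR _ _ _ (ext_lt_s8 h k) (ext_lt_s8 h (k + 1))
  omega

theorem sum_gapCount_succ (hR : OneNewGap R) (n : ℕ) (g : ℝ → ℝ) :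
    ∑ l ∈ stirlingFinset (n + 1), g (gapCount R l) =
      ∑ l ∈ stirlingFinset n, ((gapCount R l : ℝ) * g (gapCount R l)
        + (2 * n + 1 - gapCount R l) * g (gapCount R l + 1)) := by
  rw [stirlingFinset, Finset.sum_image (insertTwins_injOn n), Finset.sum_product]
  refine Finset.sum_congr rfl fun l hl => ?_
  have h := mem_stirlingFinset.1 hl
  have hstep : ∀ k ∈ Finset.range (2 * n + 1), g (gapCount R (insertTwins (n + 1) l k)) =
      g (gapCount R l + 1) + (if R (ext l k) (ext l (k + 1)) then 1 else 0) *
        (g (gapCount R l) - g (gapCount R l + 1)) := by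
    intro k hk
    have := gapCount_insertTwins hR h (Nat.lt_succ_iff.1 (Finset.mem_range.1 hk))
    split_ifs at this ⊢
    · rw [Nat.add_right_cancel this]; ring
    · rw [add_zero] at this
      rw [this]; push_cast; ring
  have hcard : ∑ k ∈ Finset.range (2 * n + 1), (if R (ext l k) (ext l (k + 1)) then (1 : ℝ) else 0)
      = gapCount R l := by
    rw [gapCount, Finset.card_filter, h.1]
    push_cast
    rfl
  rw [Finset.sum_congr rfl hstep, Finset.sum_add_distrib, ← Finset.sum_mul, hcard]
  simp
  ring

theorem card_stirlingFinset_succ (n : ℕ) :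
    ((stirlingFinset (n + 1)).card : ℝ) = (2 * n + 1) * (stirlingFinset n).card := by
  rw [stirlingFinset, Finset.card_image_of_injOn (insertTwins_injOn n), Finset.card_product]
  simp [mul_comm]

theorem card_stirlingFinset_pos (n : ℕ) : (0 : ℝ) < (stirlingFinset n).card := by
  induction n with
  | zero => simp [stirlingFinset]
  | succ n ih => rw [card_stirlingFinset_succ]; positivity

theorem sum_gapCount_succ_eq (hR : OneNewGap R) (n : ℕ) :
    ∑ l ∈ stirlingFinset (n + 1), (gapCount R l : ℝ) =
      2 * n * ∑ l ∈ stirlingFinset n, (gapCount R l : ℝ)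
        + (2 * n + 1) * (stirlingFinset n).card := by
  rw [sum_gapCount_succ hR n (fun x => x), Finset.mul_sum, mul_comm (2 * (n : ℝ) + 1),
    ← nsmul_eq_mul, ← Finset.sum_const, ← Finset.sum_add_distrib]
  exact Finset.sum_congr rfl fun l _ => by ring

theorem sum_gapCount_sq_succ_eq (hR : OneNewGap R) (n : ℕ) :
    ∑ l ∈ stirlingFinset (n + 1), (gapCount R l : ℝ) ^ 2 =
      (2 * n - 1) * ∑ l ∈ stirlingFinset n, (gapCount R l : ℝ) ^ 2
        + (4 * n + 1) * ∑ l ∈ stirlingFinset n, (gapCount R l : ℝ)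
        + (2 * n + 1) * (stirlingFinset n).card := by
  rw [sum_gapCount_succ hR n (fun x => x ^ 2), Finset.mul_sum, Finset.mul_sum,
    mul_comm (2 * (n : ℝ) + 1), ← nsmul_eq_mul, ← Finset.sum_const, ← Finset.sum_add_distrib,
    ← Finset.sum_add_distrib]
  exact Finset.sum_congr rfl fun l _ => by ring

theorem sum_gapCount_eq (hR : OneNewGap R) (n : ℕ) :
    ∑ l ∈ stirlingFinset (n + 1), (gapCount R l : ℝ) =
      (2 * n + 3) / 3 * (stirlingFinset (n + 1)).card := by
  induction n with
  | zero => rw [sum_gapCount_succ_eq hR, card_stirlingFinset_succ]; simp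
  | succ n ih =>
    rw [sum_gapCount_succ_eq hR, ih, card_stirlingFinset_succ (n + 1)]
    push_cast
    ring

theorem sum_gapCount_sq_eq (hR : OneNewGap R) (n : ℕ) :
    ∑ l ∈ stirlingFinset (n + 1), (gapCount R l : ℝ) ^ 2 =
      (2 * (((n : ℝ) + 1) ^ 2 - 1) / (9 * (2 * n + 1)) + ((2 * n + 3) / 3) ^ 2)
        * (stirlingFinset (n + 1)).card := by
  induction n with
  | zero =>
    rw [sum_gapCount_sq_succ_eq hR, card_stirlingFinset_succ]
    have h : gapCount R [] ≤ 1 := (Finset.card_filter_le _ _).trans (by simp)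
    simp only [stirlingFinset, Finset.sum_singleton]
    interval_cases gapCount R [] <;> norm_num
  | succ n ih =>
    rw [sum_gapCount_sq_succ_eq hR, ih, sum_gapCount_eq hR, card_stirlingFinset_succ (n + 1)]
    have h1 : (2 * (n : ℝ) + 1) ≠ 0 := by positivity
    have h2 : (2 * ((n : ℝ) + 1) + 1) ≠ 0 := by positivity
    push_cast
    field_simp
    ring

theorem stirlingExp_eq (n : ℕ) (f : List ℕ → ℝ) :
    stirlingExp n f = (∑ l ∈ stirlingFinset n, f l) / (stirlingFinset n).card := by
  have h : {l : List ℕ | IsStirlingPerm n l} = ↑(stirlingFinset n) :=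
    Set.ext fun l => mem_stirlingFinset.symm
  rw [stirlingExp, h, Set.ncard_coe_finset, finsum_mem_coe_finset]

theorem stirlingVar_gapCount (hR : OneNewGap R) (n : ℕ) (hn : 1 ≤ n) :
    stirlingVar n (fun l => (gapCount R l : ℝ)) =
      2 * ((n : ℝ) ^ 2 - 1) / (9 * (2 * n - 1)) := by
  obtain ⟨m, rfl⟩ := Nat.exists_eq_add_of_le' hn
  have hN := (card_stirlingFinset_pos (m + 1)).ne'
  have hE : stirlingExp (m + 1) (fun l => (gapCount R l : ℝ)) = (2 * m + 3) / 3 := by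
    rw [stirlingExp_eq, sum_gapCount_eq hR, mul_div_cancel_right₀ _ hN]
  rw [stirlingVar, hE, stirlingExp_eq, div_eq_iff hN]
  simp only [sub_sq, Finset.sum_add_distrib, Finset.sum_sub_distrib, ← Finset.sum_mul,
    ← Finset.mul_sum, sum_gapCount_eq hR, sum_gapCount_sq_eq hR, Finset.sum_const, nsmul_eq_mul]
  have h : 2 * ((m + 1 : ℕ) : ℝ) - 1 = 2 * m + 1 := by push_cast; ring
  rw [h]
  push_cast
  ring

end Gaps

theorem oneNewGap_lt : OneNewGap (· < ·) := fun a b m ha hb => by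
  simp [ha, hb.not_gt]

theorem oneNewGap_gt : OneNewGap (· > ·) := fun a b m ha hb => by
  simp [ha.not_gt, hb]

theorem oneNewGap_eq : OneNewGap (· = ·) := fun a b m ha hb => by
  simp [ha.ne, hb.ne']

/-- For every `n ≥ 1`, the variances of the numbers of ascents, descents and plateaux
of a uniformly random Stirling permutation of length `2n` all equal
`2(n²-1)/(9(2n-1))`. -/
theorem var_ascents_descents_plateaux (n : ℕ) (hn : 1 ≤ n) :
    stirlingVar n (fun l => (ascents l : ℝ)) = 2 * ((n : ℝ) ^ 2 - 1) / (9 * (2 * n - 1)) ∧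
    stirlingVar n (fun l => (descents l : ℝ)) = 2 * ((n : ℝ) ^ 2 - 1) / (9 * (2 * n - 1)) ∧
    stirlingVar n (fun l => (plateaux l : ℝ)) = 2 * ((n : ℝ) ^ 2 - 1) / (9 * (2 * n - 1)) := by
  exact ⟨stirlingVar_gapCount oneNewGap_lt n hn, stirlingVar_gapCount oneNewGap_gt n hn,
    stirlingVar_gapCount oneNewGap_eq n hn⟩
end
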